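/- arXiv:2104.02141 — 2 statements merged into one kernel-verified Lean document; each statement's English description precedes it below -/
import Mathlib

section
/- Let E : U → ℝ^{l×n} be a C^∞ matrix-valued map on an open set U ⊆ ℝⁿ with rank E(x) = r for all x ∈ U. Then every point x_p ∈ U has a neighborhood U' ⊆ U on which there exists a C^∞ map Q : U' → GL(l,ℝ) such that Q(x)E(x) = [E₁(x); 0] for all x ∈ U', where E₁ : U' → ℝ^{r×n} is C^∞ and has full row rank r at every point (the last l − r rows of Q(x)E(x) vanish identically). -/
open Matrix Set

/-- Stack an `r × n'` matrix on top of a `p × n'` matrix, obtaining an `l × n'` matrix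
(`r + p = l`). -/
def stackM {r p l : ℕ} (hl : r + p = l) {n' : Type*} (A : Matrix (Fin r) n' ℝ)
    (B : Matrix (Fin p) n' ℝ) : Matrix (Fin l) n' ℝ :=
  (Matrix.fromRows A B).submatrix (fun i => finSumFinEquiv.symm (Fin.cast hl.symm i)) id

/-- The index splitting underlying `stackM`. -/
def stackEquiv {r p l : ℕ} (hl : r + p = l) : Fin l ≃ Fin r ⊕ Fin p :=
  (finCongr hl.symm).trans finSumFinEquiv.symm

theorem stackM_apply {r p l : ℕ} (hl : r + p = l) {n' : Type*} (A : Matrix (Fin r) n' ℝ)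
    (B : Matrix (Fin p) n' ℝ) (i : Fin l) (j : n') :
    stackM hl A B i j = Matrix.fromRows A B (stackEquiv hl i) j := rfl

section Smooth

variable {F : Type*} [NormedAddCommGroup F] [NormedSpace ℝ F] {s : Set F} {N : WithTop ℕ∞}
  {ι : Type*} [Fintype ι] {M : F → Matrix ι ι ℝ}

theorem ContDiffOn.matrix_det_of_entries [DecidableEq ι]
    (hM : ∀ i j, ContDiffOn ℝ N (fun x => M x i j) s) :
    ContDiffOn ℝ N (fun x => (M x).det) s := by
  simp only [Matrix.det_apply']
  exact ContDiffOn.sum fun σ _ => contDiffOn_const.mul (contDiffOn_prod fun i _ => hM _ _)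

theorem ContDiffOn.matrix_adjugate_of_entries [DecidableEq ι]
    (hM : ∀ i j, ContDiffOn ℝ N (fun x => M x i j) s) (i j : ι) :
    ContDiffOn ℝ N (fun x => (M x).adjugate i j) s := by
  simp only [Matrix.adjugate_apply]
  refine ContDiffOn.matrix_det_of_entries fun a b => ?_
  by_cases h : a = j
  · subst h
    simpa using contDiffOn_const
  · simpa [Matrix.updateRow_ne h] using hM a b

theorem ContDiffOn.matrix_inv_of_entries [DecidableEq ι]
    (hM : ∀ i j, ContDiffOn ℝ N (fun x => M x i j) s)
    (hdet : ∀ x ∈ s, (M x).det ≠ 0) (i j : ι) :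
    ContDiffOn ℝ N (fun x => (M x)⁻¹ i j) s := by
  simp only [Matrix.inv_def, Ring.inverse_eq_inv', Matrix.smul_apply, smul_eq_mul]
  exact ((ContDiffOn.matrix_det_of_entries hM).inv hdet).mul
    (ContDiffOn.matrix_adjugate_of_entries hM i j)

theorem ContDiffOn.matrix_mul_entries {ι₁ ι₂ : Type*} {A : F → Matrix ι₁ ι ℝ}
    {B : F → Matrix ι ι₂ ℝ} (hA : ∀ i j, ContDiffOn ℝ N (fun x => A x i j) s)
    (hB : ∀ i j, ContDiffOn ℝ N (fun x => B x i j) s) (i : ι₁) (j : ι₂) :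
    ContDiffOn ℝ N (fun x => (A x * B x) i j) s := by
  simp only [Matrix.mul_apply]
  exact ContDiffOn.sum fun k _ => (hA i k).mul (hB k j)

end Smooth

/-- A basis of the column space of a rank `r` matrix `A`, written as the columns of `A * V`,
can be completed to an invertible square matrix. -/
theorem exists_isUnit_fromCols_mul {l n r : ℕ} (A : Matrix (Fin l) (Fin n) ℝ) (hA : A.rank = r) :
    ∃ p : ℕ, ∃ hl : r + p = l, ∃ (V : Matrix (Fin n) (Fin r) ℝ) (W : Matrix (Fin l) (Fin p) ℝ),
      IsUnit ((Matrix.fromCols (A * V) W).submatrix id (stackEquiv hl)) := by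
  obtain ⟨T, hT⟩ := Submodule.exists_isCompl (LinearMap.range A.mulVecLin)
  have hl : r + Module.finrank ℝ T = l := by
    rw [← hA, Matrix.rank, Submodule.finrank_add_eq_of_isCompl hT, Module.finrank_fin_fun]
  let b := Module.finBasisOfFinrankEq ℝ (LinearMap.range A.mulVecLin) hA
  let c := Module.finBasis ℝ T
  choose v hv using fun k => (b k).2
  refine ⟨_, hl, Matrix.of fun i k => v k i, Matrix.of fun i k => (c k : Fin l → ℝ) i, ?_⟩
  rw [← Matrix.linearIndependent_cols_iff_isUnit]
  have hb : LinearIndependent ℝ fun k => (b k : Fin l → ℝ) :=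
    b.linearIndependent.map' (Submodule.subtype _) (Submodule.ker_subtype _)
  have hc : LinearIndependent ℝ fun k => (c k : Fin l → ℝ) :=
    c.linearIndependent.map' (Submodule.subtype _) (Submodule.ker_subtype _)
  have hbc := hb.sum_type hc (hT.disjoint.mono
    (Submodule.span_le.2 (by rintro _ ⟨k, rfl⟩; exact (b k).2))
    (Submodule.span_le.2 (by rintro _ ⟨k, rfl⟩; exact (c k).2)))
  suffices hcol : (Matrix.col ((Matrix.fromCols (A * Matrix.of fun i k => v k i)
      (Matrix.of fun i k => (c k : Fin l → ℝ) i)).submatrix id (stackEquiv hl))) =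
      Sum.elim (fun k => (b k : Fin l → ℝ)) (fun k => (c k : Fin l → ℝ)) ∘ stackEquiv hl by
    rw [hcol]
    exact hbc.comp _ (stackEquiv hl).injective
  funext j i
  rcases h : stackEquiv hl j with k | k
  · simpa [Matrix.col, h, Matrix.mul_apply, Matrix.mulVec, dotProduct] using congrFun (hv k) i
  · simp [Matrix.col, h]

/-- If the columns of `A * V` are the first `r` columns of an invertible matrix and `A` has rank
`r`, then multiplication by the inverse annihilates the remaining rows of `A`. -/
theorem inv_fromCols_mul_eq_stackM {l n r p : ℕ} (hl : r + p = l) {A : Matrix (Fin l) (Fin n) ℝ}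
    (hA : A.rank = r) {V : Matrix (Fin n) (Fin r) ℝ} {W : Matrix (Fin l) (Fin p) ℝ}
    {M : Matrix (Fin l) (Fin l) ℝ}
    (hM : M = (Matrix.fromCols (A * V) W).submatrix id (stackEquiv hl)) (hu : IsUnit M) :
    M⁻¹ * A = stackM hl ((M⁻¹ * A).submatrix (fun i => (stackEquiv hl).symm (Sum.inl i)) id) 0 ∧
      (M⁻¹ * A).submatrix (fun i => (stackEquiv hl).symm (Sum.inl i)) id * V = 1 := by
  have hone : M⁻¹ * M = 1 := Matrix.nonsing_inv_mul M ((Matrix.isUnit_iff_isUnit_det M).1 hu)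
  have hcol (k : Fin r) : M.col ((stackEquiv hl).symm (Sum.inl k)) = A *ᵥ V.col k := by
    ext i
    simp [hM, Matrix.col, Matrix.mul_apply, Matrix.mulVec, dotProduct]
  have hQ (i : Fin l) (k : Fin r) : (M⁻¹ *ᵥ (A *ᵥ V.col k)) i =
      (1 : Matrix (Fin l) (Fin l) ℝ) i ((stackEquiv hl).symm (Sum.inl k)) := by
    rw [← hcol, ← hone]
    rfl
  have hspan : Submodule.span ℝ (Set.range fun k => A *ᵥ V.col k) =
      LinearMap.range A.mulVecLin := by
    refine Submodule.eq_of_le_of_finrank_eq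
      (Submodule.span_le.2 (by rintro _ ⟨k, rfl⟩; exact ⟨V.col k, rfl⟩)) ?_
    have hli : LinearIndependent ℝ fun k => A *ᵥ V.col k := by
      simpa only [Function.comp_def, hcol] using
        (Matrix.linearIndependent_cols_iff_isUnit.2 hu).comp
          (fun k => (stackEquiv hl).symm (Sum.inl k))
          ((stackEquiv hl).symm.injective.comp Sum.inl_injective)
    rw [finrank_span_eq_card hli, Fintype.card_fin]
    exact hA.symm
  constructor
  · ext i j
    rw [stackM_apply]
    rcases h : stackEquiv hl i with k | k
    · obtain rfl : i = (stackEquiv hl).symm (Sum.inl k) := by rw [← h, Equiv.symm_apply_apply]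
      simp
    · have hle : LinearMap.range A.mulVecLin ≤
          LinearMap.ker (LinearMap.proj i ∘ₗ M⁻¹.mulVecLin) := by
        rw [← hspan, Submodule.span_le]
        rintro _ ⟨m, rfl⟩
        have hne : i ≠ (stackEquiv hl).symm (Sum.inl m) := by
          rintro rfl
          simp at h
        simpa [Matrix.one_apply_ne hne] using hQ i m
      have h0 := hle ⟨Pi.single j 1, rfl⟩
      simpa [Matrix.mul_apply, Matrix.mulVec, dotProduct, Pi.single_apply] using h0
  · ext i k
    have h := hQ ((stackEquiv hl).symm (Sum.inl i)) k
    rw [Matrix.mulVec_mulVec] at h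
    simpa [Matrix.one_apply, Matrix.mul_apply, Matrix.mulVec, dotProduct] using h

/-- If `E : U → ℝ^{l×n}` is `C^∞` with constant rank `r`, then locally
around every point there is a `C^∞` map `Q` with values in `GL(l,ℝ)` such that
`Q(x)E(x) = [E₁(x); 0]` with `E₁` of full row rank `r`. -/
theorem stmt_14 {l n r : ℕ} (U : Set (Fin n → ℝ)) (hUo : IsOpen U)
    (E : (Fin n → ℝ) → Matrix (Fin l) (Fin n) ℝ)
    (hE : ∀ i j, ContDiffOn ℝ (⊤ : ℕ∞) (fun x => E x i j) U)
    (hrank : ∀ x ∈ U, (E x).rank = r) :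
    ∀ xp ∈ U, ∃ p : ℕ, ∃ hl : r + p = l, ∃ U' ⊆ U, IsOpen U' ∧ xp ∈ U' ∧
      ∃ (Q : (Fin n → ℝ) → Matrix (Fin l) (Fin l) ℝ)
        (E₁ : (Fin n → ℝ) → Matrix (Fin r) (Fin n) ℝ),
        (∀ i j, ContDiffOn ℝ (⊤ : ℕ∞) (fun x => Q x i j) U') ∧
        (∀ x ∈ U', IsUnit (Q x)) ∧
        (∀ i j, ContDiffOn ℝ (⊤ : ℕ∞) (fun x => E₁ x i j) U') ∧
        (∀ x ∈ U', Function.Surjective (E₁ x).mulVecLin) ∧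
        (∀ x ∈ U', Q x * E x = stackM hl (E₁ x) 0) := by
  intro xp hxp
  obtain ⟨p, hl, V, W, hVW⟩ := exists_isUnit_fromCols_mul (E xp) (hrank xp hxp)
  set M : (Fin n → ℝ) → Matrix (Fin l) (Fin l) ℝ := fun x =>
    (Matrix.fromCols (E x * V) W).submatrix id (stackEquiv hl) with hMdef
  have hM : ∀ i j, ContDiffOn ℝ (⊤ : ℕ∞) (fun x => M x i j) U := by
    intro i j
    rcases h : stackEquiv hl j with k | k
    · simpa [hMdef, h] using
        ContDiffOn.matrix_mul_entries hE (fun _ _ => contDiffOn_const (c := V _ _)) i k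
    · simpa [hMdef, h] using contDiffOn_const
  have hsub : U ∩ (fun x => (M x).det) ⁻¹' {0}ᶜ ⊆ U := Set.inter_subset_left
  have hunit : ∀ x ∈ U ∩ (fun x => (M x).det) ⁻¹' {0}ᶜ, IsUnit (M x) := fun x hx =>
    (Matrix.isUnit_iff_isUnit_det _).2 (isUnit_iff_ne_zero.2 hx.2)
  have hQ := ContDiffOn.matrix_inv_of_entries (fun i j => (hM i j).mono hsub) fun x hx => hx.2
  refine ⟨p, hl, U ∩ (fun x => (M x).det) ⁻¹' {0}ᶜ, hsub,
    (ContDiffOn.matrix_det_of_entries hM).continuousOn.isOpen_inter_preimage hUo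
      isOpen_compl_singleton,
    ⟨hxp, ((Matrix.isUnit_iff_isUnit_det _).1 hVW).ne_zero⟩, fun x => (M x)⁻¹,
    fun x => ((M x)⁻¹ * E x).submatrix (fun i => (stackEquiv hl).symm (Sum.inl i)) id,
    hQ, fun x hx => Matrix.isUnit_nonsing_inv_iff.2 (hunit x hx),
    fun i j => ContDiffOn.matrix_mul_entries hQ (fun i j => (hE i j).mono hsub) _ j,
    fun x hx y => ⟨V *ᵥ y, ?_⟩,
    fun x hx => (inv_fromCols_mul_eq_stackM hl (hrank x hx.1) rfl (hunit x hx)).1⟩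
  rw [Matrix.mulVecLin_apply, Matrix.mulVec_mulVec]
  beta_reduce
  rw [(inv_fromCols_mul_eq_stackM hl (hrank x hx.1) rfl (hunit x hx)).2, Matrix.one_mulVec]
end

section
/- Let f, g^u, g^v be C^∞ vector fields on an open set U ⊆ ℝⁿ, let h^u, h^v : U → ℝ be C^∞ functions, let z_a ∈ U, and let ρ ≥ ρ̄ ≥ 1 be integers with ρ + ρ̄ = n. Assume that on all of U: ⟨dh^u, ad_f^i g^u⟩ = 0 for 0 ≤ i ≤ ρ−2; ⟨dh^u, ad_f^i g^v⟩ = 0 for 0 ≤ i ≤ ρ−1; ⟨dh^v, ad_f^i g^u⟩ = 0 and ⟨dh^v, ad_f^i g^v⟩ = 0 for 0 ≤ i ≤ ρ̄−2; and that at z_a: ⟨dh^u(z_a), ad_f^{ρ−1}g^u(z_a)⟩ ≠ 0 and ⟨dh^v(z_a), ad_f^{ρ̄−1}g^v(z_a)⟩ ≠ 0. Then the n covectors dL_f^i h^u(z_a) for 0 ≤ i ≤ ρ−1 and dL_f^j h^v(z_a) for 0 ≤ j ≤ ρ̄−1 are linearly independent; consequently the map ψ = (h^u, L_f h^u, …,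 L_f^{ρ−1}h^u, h^v, …, L_f^{ρ̄−1}h^v) is a local diffeomorphism at z_a. -/
open Matrix Set

/-- The Lie bracket `[f,g](x) = Dg(x)f(x) − Df(x)g(x)` of vector fields on `ℝⁿ`. -/
noncomputable def lieB {n : ℕ} (f g : (Fin n → ℝ) → Fin n → ℝ) : (Fin n → ℝ) → Fin n → ℝ :=
  fun x => fderiv ℝ g x (f x) - fderiv ℝ f x (g x)

/-- Iterated adjoint: `ad_f⁰ g = g`, `ad_f^{q+1} g = [f, ad_f^q g]`. -/
noncomputable def adIter {n : ℕ} (f g : (Fin n → ℝ) → Fin n → ℝ) :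
    ℕ → (Fin n → ℝ) → Fin n → ℝ
  | 0 => g
  | q + 1 => lieB f (adIter f g q)

/-- Iterated Lie derivative of a function along `f`: `L_f⁰ h = h`,
`L_f^{i+1} h = ⟨d(L_f^i h), f⟩`. -/
noncomputable def lfIter {n : ℕ} (f : (Fin n → ℝ) → Fin n → ℝ) (h : (Fin n → ℝ) → ℝ) :
    ℕ → (Fin n → ℝ) → ℝ
  | 0 => h
  | i + 1 => fun z => fderiv ℝ (lfIter f h i) z (f z)

section PairingLemmas

variable {n : ℕ} {U : Set (Fin n → ℝ)} {f g : (Fin n → ℝ) → Fin n → ℝ} {h : (Fin n → ℝ) → ℝ}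

theorem contDiffOn_adIter (hU : IsOpen U) (hf : ContDiffOn ℝ (⊤ : ℕ∞) f U)
    (hg : ContDiffOn ℝ (⊤ : ℕ∞) g U) (k : ℕ) : ContDiffOn ℝ (⊤ : ℕ∞) (adIter f g k) U := by
  induction k with
  | zero => exact hg
  | succ k ih =>
    exact ((ih.fderiv_of_isOpen hU le_rfl).clm_apply hf).sub
      ((hf.fderiv_of_isOpen hU le_rfl).clm_apply ih)

theorem contDiffOn_lfIter (hU : IsOpen U) (hf : ContDiffOn ℝ (⊤ : ℕ∞) f U)
    (hh : ContDiffOn ℝ (⊤ : ℕ∞) h U) (k : ℕ) : ContDiffOn ℝ (⊤ : ℕ∞) (lfIter f h k) U := by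
  induction k with
  | zero => exact hh
  | succ k ih => exact (ih.fderiv_of_isOpen hU le_rfl).clm_apply hf

/-- The Leibniz rule `L_f ⟨dφ, X⟩ = ⟨d(L_f φ), X⟩ + ⟨dφ, [f, X]⟩`. -/
theorem fderiv_pairing_lieB (hU : IsOpen U) {φ : (Fin n → ℝ) → ℝ} {X : (Fin n → ℝ) → Fin n → ℝ}
    (hf : ContDiffOn ℝ (⊤ : ℕ∞) f U) (hφ : ContDiffOn ℝ (⊤ : ℕ∞) φ U)
    (hX : ContDiffOn ℝ (⊤ : ℕ∞) X U) {z : Fin n → ℝ} (hz : z ∈ U) :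
    fderiv ℝ (fun y => fderiv ℝ φ y (X y)) z (f z) =
      fderiv ℝ (fun y => fderiv ℝ φ y (f y)) z (X z) + fderiv ℝ φ z (lieB f X z) := by
  have hUz := hU.mem_nhds hz
  have hne : ((⊤ : ℕ∞) : WithTop ℕ∞) ≠ 0 := by simp
  have dφ : DifferentiableAt ℝ (fderiv ℝ φ) z :=
    ((hφ.fderiv_of_isOpen hU (m := (⊤ : ℕ∞)) le_rfl).contDiffAt hUz).differentiableAt hne
  have df : DifferentiableAt ℝ f z := (hf.contDiffAt hUz).differentiableAt hne
  have dX : DifferentiableAt ℝ X z := (hX.contDiffAt hUz).differentiableAt hne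
  have hsymm : IsSymmSndFDerivAt ℝ φ z :=
    (hφ.contDiffAt hUz).isSymmSndFDerivAt (by
      rw [minSmoothness_of_isRCLikeNormedField]
      exact WithTop.coe_le_coe.mpr le_top)
  rw [fderiv_clm_apply dφ dX, fderiv_clm_apply dφ df]
  simp only [lieB, _root_.add_apply, ContinuousLinearMap.comp_apply,
    ContinuousLinearMap.flip_apply, map_sub]
  rw [hsymm.eq (f z) (X z)]
  ring

/-- If `⟨dh, ad_f^k g⟩` vanishes on `U` for `k < r`, then
`⟨d(L_f^i h), ad_f^j g⟩ = (-1)^i ⟨dh, ad_f^{i+j} g⟩` on `U` for `i + j ≤ r`. -/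
theorem fderiv_lfIter_adIter (hU : IsOpen U) (hf : ContDiffOn ℝ (⊤ : ℕ∞) f U)
    (hg : ContDiffOn ℝ (⊤ : ℕ∞) g U) (hh : ContDiffOn ℝ (⊤ : ℕ∞) h U) {r : ℕ}
    (hr : ∀ z ∈ U, ∀ k < r, fderiv ℝ h z (adIter f g k z) = 0) (i : ℕ) :
    ∀ j, i + j ≤ r → ∀ z ∈ U, fderiv ℝ (lfIter f h i) z (adIter f g j z) =
      (-1) ^ i * fderiv ℝ h z (adIter f g (i + j) z) := by
  induction i with
  | zero => intro j _ z _; simp [lfIter]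
  | succ i ih =>
    intro j hij z hz
    have key := fderiv_pairing_lieB hU hf (contDiffOn_lfIter hU hf hh i)
      (contDiffOn_adIter hU hf hg j) hz
    have hzero : (fun y => fderiv ℝ (lfIter f h i) y (adIter f g j y)) =ᶠ[nhds z]
        fun _ => (0 : ℝ) := by
      filter_upwards [hU.mem_nhds hz] with y hy
      rw [ih j (by omega) y hy, hr y hy _ (by omega), mul_zero]
    have hnext : fderiv ℝ (lfIter f h i) z (lieB f (adIter f g j) z) =
        (-1) ^ i * fderiv ℝ h z (adIter f g (i + (j + 1)) z) := ih (j + 1) (by omega) z hz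
    rw [hzero.fderiv_eq] at key
    rw [hnext] at key
    simp only [fderiv_fun_const, Pi.zero_apply, _root_.zero_apply] at key
    rw [show i + 1 + j = i + (j + 1) by omega, pow_succ]
    simp only [lfIter]
    linarith

end PairingLemmas

/-- Covectors `F` and vectors `u k`, `v k` whose pairings form a block-triangular array with
nonzero diagonal: the covectors are linearly independent. -/
theorem linearIndependent_of_triangular_pairing {E : Type*} [NormedAddCommGroup E]
    [NormedSpace ℝ E] {n ρ ρbar : ℕ} (hn : ρ + ρbar = n) (F : Fin n → E →L[ℝ] ℝ) (u v : ℕ → E)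
    (huu : ∀ (i : Fin n) (k : ℕ), i < ρ → i + k + 1 < ρ → F i (u k) = 0)
    (huu' : ∀ (i : Fin n) (k : ℕ), i < ρ → i + k + 1 = ρ → F i (u k) ≠ 0)
    (huv : ∀ (i : Fin n) (k : ℕ), i < ρ → i + k < ρ → F i (v k) = 0)
    (hvu : ∀ (i : Fin n) (k : ℕ), ρ ≤ i → i + k + 1 < n → F i (u k) = 0)
    (hvv : ∀ (i : Fin n) (k : ℕ), ρ ≤ i → i + k + 1 < n → F i (v k) = 0)
    (hvv' : ∀ (i : Fin n) (k : ℕ), ρ ≤ i → i + k + 1 = n → F i (v k) ≠ 0) :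
    LinearIndependent ℝ F := by
  rw [Fintype.linearIndependent_iff]
  intro c hc
  have happ (x : E) : ∑ i, c i * F i x = 0 := by
    simpa using congrArg (fun L : E →L[ℝ] ℝ => L x) hc
  have key (k : ℕ) : (∀ i : Fin n, i < ρ → ρ ≤ i + k → c i = 0) ∧
      (∀ i : Fin n, ρ ≤ i → n ≤ i + k → c i = 0) := by
    induction k with
    | zero => exact ⟨fun i _ _ => by omega, fun i _ _ => by omega⟩
    | succ k ih =>
      obtain ⟨iha, ihb⟩ := ih
      have hb : ∀ i : Fin n, ρ ≤ i → n ≤ i + (k + 1) → c i = 0 := by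
        intro i hi hik
        rcases Nat.lt_or_ge (i + k) n with hlt | hge
        · have hs := happ (v k)
          rw [Finset.sum_eq_single i] at hs
          · exact (mul_eq_zero.mp hs).resolve_right (hvv' i k hi (by omega))
          · intro j _ hji
            have hne : (j : ℕ) ≠ i := fun h => hji (Fin.ext h)
            rcases Nat.lt_or_ge j ρ with hj | hj
            · rcases Nat.lt_or_ge (j + k) ρ with hjk | hjk
              · rw [huv j k hj hjk, mul_zero]
              · rw [iha j hj hjk, zero_mul]
            · rcases Nat.lt_or_ge (j + k) n with hjk | hjk
              · rw [hvv j k hj (by omega), mul_zero]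
              · rw [ihb j hj hjk, zero_mul]
          · simp
        · exact ihb i hi hge
      refine ⟨fun i hi hik => ?_, hb⟩
      rcases Nat.lt_or_ge (i + k) ρ with hlt | hge
      · have hs := happ (u k)
        rw [Finset.sum_eq_single i] at hs
        · exact (mul_eq_zero.mp hs).resolve_right (huu' i k hi (by omega))
        · intro j _ hji
          have hne : (j : ℕ) ≠ i := fun h => hji (Fin.ext h)
          rcases Nat.lt_or_ge j ρ with hj | hj
          · rcases Nat.lt_or_ge (j + k) ρ with hjk | hjk
            · rw [huu j k hj (by omega), mul_zero]
            · rw [iha j hj hjk, zero_mul]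
          · rcases Nat.lt_or_ge (j + k + 1) n with hjk | hjk
            · rw [hvu j k hj hjk, mul_zero]
            · rw [hb j hj (by omega), zero_mul]
        · simp
      · exact iha i hi hge
  intro i
  rcases Nat.lt_or_ge i ρ with hi | hi
  · exact (key n).1 i hi (by omega)
  · exact (key n).2 i hi (by omega)

/-- `n` linearly independent covectors on `ℝⁿ` are the components of an invertible map. -/
theorem exists_equiv_of_linearIndependent {n : ℕ} {F : Fin n → (Fin n → ℝ) →L[ℝ] ℝ}
    (hF : LinearIndependent ℝ F) :
    ∃ e : (Fin n → ℝ) ≃L[ℝ] (Fin n → ℝ), (e : (Fin n → ℝ) →L[ℝ] (Fin n → ℝ)) =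
      ContinuousLinearMap.pi F := by
  let A : (Fin n → ℝ) →ₗ[ℝ] (Fin n → ℝ) := (ContinuousLinearMap.pi F).toLinearMap
  have hinj : Function.Injective A := by
    rw [← LinearMap.ker_eq_bot, LinearMap.ker_eq_bot']
    intro x hx
    let G : Fin n → Module.Dual ℝ (Fin n → ℝ) := fun i => (F i).toLinearMap
    have hG : LinearIndependent ℝ G :=
      hF.map' (ContinuousLinearMap.coeLM ℝ) (LinearMap.ker_eq_bot.mpr
        ContinuousLinearMap.coe_injective)
    have hspan := hG.span_eq_top_of_card_eq_finrank' (by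
      simp [Subspace.dual_finrank_eq])
    have hall : ∀ L : Module.Dual ℝ (Fin n → ℝ), L x = 0 := by
      intro L
      have hL : L ∈ Submodule.span ℝ (Set.range G) := hspan ▸ Submodule.mem_top
      induction hL using Submodule.span_induction with
      | mem y hy =>
        obtain ⟨i, rfl⟩ := hy
        exact congrFun hx i
      | zero => rfl
      | add y w _ _ hy hw => simp [hy, hw]
      | smul a y _ hy => simp [hy]
    ext i
    exact hall (LinearMap.proj i)
  refine ⟨(LinearEquiv.ofInjectiveEndo A hinj).toContinuousLinearEquiv, ?_⟩
  ext x i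
  rfl

/-- The inverse function theorem for a smooth map on an open set, as a local diffeomorphism. -/
theorem exists_local_diffeomorphism {E : Type*} [NormedAddCommGroup E] [NormedSpace ℝ E]
    [CompleteSpace E] {U : Set E} (hU : IsOpen U) {ψ : E → E}
    (hψ : ContDiffOn ℝ (⊤ : ℕ∞) ψ U) {a : E} (ha : a ∈ U) (e : E ≃L[ℝ] E)
    (he : (e : E →L[ℝ] E) = fderiv ℝ ψ a) :
    ∃ V ⊆ U, IsOpen V ∧ a ∈ V ∧ Set.InjOn ψ V ∧ IsOpen (ψ '' V) ∧
      ∃ ψinv : E → E, ContDiffOn ℝ (⊤ : ℕ∞) ψinv (ψ '' V) ∧ ∀ z ∈ V, ψinv (ψ z) = z := by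
  have hne : ((⊤ : ℕ∞) : WithTop ℕ∞) ≠ 0 := by simp
  have hat : ContDiffAt ℝ (⊤ : ℕ∞) ψ a := hψ.contDiffAt (hU.mem_nhds ha)
  have hstrict : HasStrictFDerivAt ψ (e : E →L[ℝ] E) a := he ▸ hat.hasStrictFDerivAt hne
  let Φ := hstrict.toOpenPartialHomeomorph ψ
  have hΦ : (Φ : E → E) = ψ := hstrict.toOpenPartialHomeomorph_coe
  have hopen : IsOpen (U ∩ fderiv ℝ ψ ⁻¹' Set.range ((↑) : (E ≃L[ℝ] E) → E →L[ℝ] E)) :=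
    (hψ.continuousOn_fderiv_of_isOpen hU (by simp)).isOpen_inter_preimage hU
      ContinuousLinearEquiv.isOpen
  set W := U ∩ fderiv ℝ ψ ⁻¹' Set.range ((↑) : (E ≃L[ℝ] E) → E →L[ℝ] E)
  have hVo : IsOpen (Φ.source ∩ W) := Φ.open_source.inter hopen
  refine ⟨Φ.source ∩ W, fun z hz => hz.2.1, hVo,
    ⟨hstrict.mem_toOpenPartialHomeomorph_source, ha, e, he⟩, ?_, ?_, Φ.symm, ?_, ?_⟩
  · exact hΦ ▸ Φ.injOn.mono Set.inter_subset_left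
  · rw [← hΦ]
    exact Φ.isOpen_image_of_subset_source hVo Set.inter_subset_left
  · rintro _ ⟨z, ⟨hzs, hzU, e', he'⟩, rfl⟩
    have hz : Φ.symm (ψ z) = z := hΦ ▸ Φ.left_inv hzs
    have hcd : ContDiffAt ℝ (⊤ : ℕ∞) ψ z := hψ.contDiffAt (hU.mem_nhds hzU)
    have hd : HasFDerivAt ψ (e' : E →L[ℝ] E) z :=
      he' ▸ (hcd.differentiableAt hne).hasFDerivAt
    refine (Φ.contDiffAt_symm (f₀' := e') (hΦ ▸ Φ.map_source hzs) ?_ ?_).contDiffWithinAt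
    · rw [hz, hΦ]; exact hd
    · rw [hz, hΦ]; exact hcd
  · intro z hz
    exact hΦ ▸ Φ.left_inv hz.1

/-- Under the stated annihilation conditions on `U` and nondegeneracy at
`z_a`, the `n` covectors `dL_f^i h^u(z_a)` (`0 ≤ i ≤ ρ−1`) and `dL_f^j h^v(z_a)`
(`0 ≤ j ≤ ρ̄−1`) are linearly independent; consequently
`ψ = (h^u, …, L_f^{ρ−1}h^u, h^v, …, L_f^{ρ̄−1}h^v)` is a local diffeomorphism at `z_a`. -/
theorem stmt_16 {n ρ ρbar : ℕ} (hρ1 : 1 ≤ ρbar) (hρ2 : ρbar ≤ ρ) (hn : ρ + ρbar = n)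
    (U : Set (Fin n → ℝ)) (hUo : IsOpen U) (za : Fin n → ℝ) (hza : za ∈ U)
    (f gu gv : (Fin n → ℝ) → Fin n → ℝ) (hu hv : (Fin n → ℝ) → ℝ)
    (hf : ContDiffOn ℝ (⊤ : ℕ∞) f U) (hgu : ContDiffOn ℝ (⊤ : ℕ∞) gu U) (hgv : ContDiffOn ℝ (⊤ : ℕ∞) gv U)
    (hhu : ContDiffOn ℝ (⊤ : ℕ∞) hu U) (hhv : ContDiffOn ℝ (⊤ : ℕ∞) hv U)
    (h1 : ∀ z ∈ U, ∀ i : ℕ, i + 2 ≤ ρ → fderiv ℝ hu z (adIter f gu i z) = 0)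
    (h2 : ∀ z ∈ U, ∀ i : ℕ, i < ρ → fderiv ℝ hu z (adIter f gv i z) = 0)
    (h3 : ∀ z ∈ U, ∀ i : ℕ, i + 2 ≤ ρbar → fderiv ℝ hv z (adIter f gu i z) = 0)
    (h4 : ∀ z ∈ U, ∀ i : ℕ, i + 2 ≤ ρbar → fderiv ℝ hv z (adIter f gv i z) = 0)
    (h5 : fderiv ℝ hu za (adIter f gu (ρ - 1) za) ≠ 0)
    (h6 : fderiv ℝ hv za (adIter f gv (ρbar - 1) za) ≠ 0) :
    LinearIndependent ℝ (fun i : Fin n =>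
      if (i : ℕ) < ρ then fderiv ℝ (lfIter f hu (i : ℕ)) za
      else fderiv ℝ (lfIter f hv ((i : ℕ) - ρ)) za) ∧
    ∃ V ⊆ U, IsOpen V ∧ za ∈ V ∧
      Set.InjOn (fun z => fun i : Fin n =>
        if (i : ℕ) < ρ then lfIter f hu (i : ℕ) z else lfIter f hv ((i : ℕ) - ρ) z) V ∧
      IsOpen ((fun z => fun i : Fin n =>
        if (i : ℕ) < ρ then lfIter f hu (i : ℕ) z else lfIter f hv ((i : ℕ) - ρ) z) '' V) ∧
      ∃ ψinv : (Fin n → ℝ) → Fin n → ℝ,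
        ContDiffOn ℝ (⊤ : ℕ∞) ψinv ((fun z => fun i : Fin n =>
          if (i : ℕ) < ρ then lfIter f hu (i : ℕ) z else lfIter f hv ((i : ℕ) - ρ) z) '' V) ∧
        ∀ z ∈ V, ψinv (fun i : Fin n =>
          if (i : ℕ) < ρ then lfIter f hu (i : ℕ) z else lfIter f hv ((i : ℕ) - ρ) z) = z := by
  have hlin : LinearIndependent ℝ (fun i : Fin n =>
      if (i : ℕ) < ρ then fderiv ℝ (lfIter f hu (i : ℕ)) za
      else fderiv ℝ (lfIter f hv ((i : ℕ) - ρ)) za) := by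
    have puu := fderiv_lfIter_adIter hUo hf hgu hhu (r := ρ - 1)
      fun z hz k hk => h1 z hz k (by omega)
    have puv := fderiv_lfIter_adIter hUo hf hgv hhu h2
    have pvu := fderiv_lfIter_adIter hUo hf hgu hhv (r := ρbar - 1)
      fun z hz k hk => h3 z hz k (by omega)
    have pvv := fderiv_lfIter_adIter hUo hf hgv hhv (r := ρbar - 1)
      fun z hz k hk => h4 z hz k (by omega)
    refine linearIndependent_of_triangular_pairing hn _ (fun k => adIter f gu k za)
      (fun k => adIter f gv k za) ?_ ?_ ?_ ?_ ?_ ?_ <;> intro i k hi hik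
    · rw [if_pos hi, puu i k (by omega) za hza, h1 za hza _ (by omega), mul_zero]
    · rw [if_pos hi, puu i k (by omega) za hza, show (i : ℕ) + k = ρ - 1 by omega]
      exact mul_ne_zero (by simp) h5
    · rw [if_pos hi, puv i k (by omega) za hza, h2 za hza _ (by omega), mul_zero]
    · rw [if_neg (by omega), pvu _ k (by omega) za hza, h3 za hza _ (by omega), mul_zero]
    · rw [if_neg (by omega), pvv _ k (by omega) za hza, h4 za hza _ (by omega), mul_zero]
    · rw [if_neg (by omega), pvv _ k (by omega) za hza,
        show (i : ℕ) - ρ + k = ρbar - 1 by omega]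
      exact mul_ne_zero (by simp) h6
  refine ⟨hlin, ?_⟩
  have hcomp (i : Fin n) : ContDiffOn ℝ (⊤ : ℕ∞) (fun z =>
      if (i : ℕ) < ρ then lfIter f hu (i : ℕ) z else lfIter f hv ((i : ℕ) - ρ) z) U := by
    split_ifs
    · exact contDiffOn_lfIter hUo hf hhu _
    · exact contDiffOn_lfIter hUo hf hhv _
  obtain ⟨e, he⟩ := exists_equiv_of_linearIndependent hlin
  refine exists_local_diffeomorphism hUo (contDiffOn_pi.mpr hcomp) hza e ?_
  rw [he, fderiv_pi fun i => ((hcomp i).contDiffAt (hUo.mem_nhds hza)).differentiableAt (by simp)]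
  congr 1
  funext i
  split_ifs <;> rfl
end
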